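/- For every vertex x ≠ 0 of the tree, the second moment of the hitting time of x starting from its parent p(x) satisfies E[(T^{p(x)}_x)²] = (2/(μ_x·π(x)))·( Σ_{c∈C_x} π(B_c)²/(μ_c·π(c)) + Σ_{b∈ℓ(x)} π(I∖B_b)²/(μ_b·π(b)) ) − E[T^{p(x)}_x], where C_x := ∪_{l=1}^{d(x)} ∪_{c∈σ(x_l), c≠x_{l−1}} B_c is the union, over all vertices x_l on the path from p(x) to 0 (with x_{d(x)} = 0), of the branches stemming from the children of x_l other than x_{l−1}. -/

import Mathlib

open MeasureTheory ProbabilityTheory Filter Topology ENNReal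

noncomputable section

/-- A discrete-time birth-and-death chain on a countable rooted tree `I`.
The tree is encoded by a root, a parent map and a depth function; the chain is
encoded by its transition matrix `P` (nonzero only between tree-neighbours and
on the diagonal) and by the laws `law x` of the trajectories started at `x`,
characterised by the cylinder formula.  `invm` is the reversible invariant
probability measure of the chain (positive recurrence). -/
structure TreeChain (I : Type*) [MeasurableSpace I] where
  root : I
  par : I → I
  depth : I → ℕ
  par_root : par root = root
  depth_root : depth root = 0
  depth_eq_zero : ∀ x, depth x = 0 → x = root
  depth_par : ∀ x, x ≠ root → depth x = depth (par x) + 1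
  P : I → I → ℝ≥0∞
  P_row : ∀ x, ∑' y, P x y = 1
  P_support : ∀ x y, P x y ≠ 0 → y = x ∨ y = par x ∨ x = par y
  lam_pos : ∀ x, x ≠ root → P (par x) x ≠ 0
  mu_pos : ∀ x, x ≠ root → P x (par x) ≠ 0
  law : I → Measure (ℕ → I)
  law_prob : ∀ x, IsProbabilityMeasure (law x)
  law_start : ∀ x, law x {ω | ω 0 = x} = 1
  law_cyl : ∀ x (n : ℕ) (γ : ℕ → I), γ 0 = x →
    law x {ω | ∀ i ≤ n, ω i = γ i} = ∏ i ∈ Finset.range n, P (γ i) (γ (i + 1))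
  invm : I → ℝ≥0∞
  invm_pos : ∀ x, invm x ≠ 0
  invm_sum : ∑' x, invm x = 1
  invm_rev : ∀ x y, invm x * P x y = invm y * P y x

/-- The hitting time of `y`, as an extended nonnegative real (`∞` if `y` is never hit). -/
def hitTime {I : Type*} (y : I) (ω : ℕ → I) : ℝ≥0∞ :=
  ⨅ (t : ℕ) (_ : ω t = y), (t : ℝ≥0∞)

namespace TreeChain

variable {I : Type*} [MeasurableSpace I] (c : TreeChain I)

/-- The branch `B_x` stemming from `x`: the set of descendants of `x` (including `x`). -/
def branch (x : I) : Set I := {y | ∃ n, c.par^[n] y = x}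

/-- The set `ℓ(x)` of vertices on the path from `x` to the root, the root excluded. -/
def pathToRoot (x : I) : Set I := {y | ∃ i < c.depth x, c.par^[i] x = y}

/-- The set `σ(x)` of children of `x`. -/
def children (x : I) : Set I := {y | y ≠ c.root ∧ c.par y = x}

/-- `μ_x`, the transition probability from `x` to its parent. -/
def mu (x : I) : ℝ≥0∞ := c.P x (c.par x)

/-- `λ_x`, the transition probability from the parent of `x` to `x`. -/
def lamP (x : I) : ℝ≥0∞ := c.P (c.par x) x

/-- `π(A)`, the invariant mass of a set of vertices. -/
def piSet (A : Set I) : ℝ≥0∞ := ∑' y : A, c.invm (y : I)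

/-- `E[T^x_y]`, the expected hitting time of `y` for the chain started at `x`. -/
def ET (x y : I) : ℝ≥0∞ := ∫⁻ ω, hitTime y ω ∂(c.law x)

/-- `E[(T^x_y)²]`, the second moment of the hitting time of `y` started at `x`. -/
def ET2 (x y : I) : ℝ≥0∞ := ∫⁻ ω, (hitTime y ω) ^ 2 ∂(c.law x)

/-- The normalised hitting time `T^x_y / E[T^x_y]` as a real random variable. -/
def ratio (x y : I) (ω : ℕ → I) : ℝ := (hitTime y ω).toReal / (c.ET x y).toReal

/-- `α(a)`: the child of the root lying on the path from `a` to the root. -/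
def alphaVert (a : I) : I := c.par^[c.depth a - 1] a

/-- The drift constant `K_a = sup_{b ∈ B_{α(a)}} μ_b · E[T^b_{p(b)}]`. -/
def Kdrift (a : I) : ℝ≥0∞ :=
  ⨆ b ∈ c.branch (c.alphaVert a), c.mu b * c.ET b (c.par b)

/-- The global constant `K'_a = sup_{b ∈ I} μ_b · E[T^b_{p(b)}]`. -/
def Kdrift' : ℝ≥0∞ := ⨆ b : I, c.mu b * c.ET b (c.par b)

/-- The quantity `Q_x = π(B_x)⁻¹ · Σ_{b ∈ B_x} π(B_b)²/(μ_b π(b))`. -/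
def Qx (x : I) : ℝ≥0∞ :=
  (c.piSet (c.branch x))⁻¹ *
    ∑' b : c.branch x, (c.piSet (c.branch (b : I))) ^ 2 / (c.mu (b : I) * c.invm (b : I))

/-- `Q_a = sup_{x ∈ ℓ(a)} Q_x`. -/
def Qsup (a : I) : ℝ≥0∞ := ⨆ x ∈ c.pathToRoot a, c.Qx x

/-- `R_a = Σ_{b ∈ ℓ(a)} π(B_b)²/(μ_b π(b))`. -/
def Rsum (a : I) : ℝ≥0∞ :=
  ∑' b : c.pathToRoot a, (c.piSet (c.branch (b : I))) ^ 2 / (c.mu (b : I) * c.invm (b : I))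

/-- The set `C_{a,k}`: union over the vertices `a_l`, `k < l ≤ d(a)`, of the path from
`a_k` to the root, of the branches stemming from the children of `a_l` other
than `a_{l-1}`. -/
def Cset (a : I) (k : ℕ) : Set I :=
  {y | ∃ l, k + 1 ≤ l ∧ l ≤ c.depth a ∧
    ∃ ch, ch ∈ c.children (c.par^[l] a) ∧ ch ≠ c.par^[l - 1] a ∧ y ∈ c.branch ch}

end TreeChain

/-- The strong drift condition `0^ℓ-SD` toward the root, for a family of chains
`c n` with distinguished vertices `a n` (the limit `a → ∞` being `n → ∞`). -/
def StrongDrift {I : ℕ → Type*} [∀ n, MeasurableSpace (I n)]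
    (c : ∀ n, TreeChain (I n)) (a : ∀ n, I n) : Prop :=
  (∃ Kmu : ℝ≥0∞, 0 < Kmu ∧
      ∀ n, ∀ b ∈ (c n).branch ((c n).alphaVert (a n)), Kmu ≤ (c n).mu b) ∧
  Tendsto (fun n => ((c n).Kdrift (a n)) ^ 2 / (c n).ET (a n) (c n).root) atTop (𝓝 0)



namespace TreeChain

variable {I : Type*} [MeasurableSpace I] (c : TreeChain I)

lemma law_start_and_step (z w : I) :
    c.law z {ω | ω 0 = z ∧ ω 1 = w} = c.P z w := by
  have h := c.law_cyl z 1 (fun i => if i = 0 then z else w) (by simp)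
  simp only [Finset.range_one, Finset.prod_singleton, if_true, zero_add, one_ne_zero,
    if_false] at h
  rw [← h]
  congr 1
  ext ω
  simp only [Set.mem_ofPred_eq]
  constructor
  · rintro ⟨h0, h1⟩ i hi
    interval_cases i <;> simpa
  · intro h
    exact ⟨by simpa using h 0 (by simp), by simpa using h 1 le_rfl⟩

lemma P_eq_zero_of_indistinguishable [Countable I] {y y' : I} (hne : y ≠ y')
    (h : ∀ s : Set I, MeasurableSet s → y ∈ s → y' ∈ s) (z : I) : c.P z y' = 0 := by
  classical
  set A : Set (ℕ → I) := {ω | ω 0 = z ∧ ω 1 = y} with hA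
  set A' : Set (ℕ → I) := {ω | ω 0 = z ∧ ω 1 = y'} with hA'
  have hsub : A' ⊆ toMeasurable (c.law z) A := by
    intro ω hω
    have hm : MeasurableSet (Function.update ω 1 ⁻¹' toMeasurable (c.law z) A) :=
      measurable_update ω (measurableSet_toMeasurable _ _)
    have hy : y ∈ Function.update ω 1 ⁻¹' toMeasurable (c.law z) A := by
      refine subset_toMeasurable (c.law z) A ?_
      simpa [hA] using hω.1
    have := h _ hm hy
    rw [Set.mem_preimage, ← hω.2, Function.update_eq_self] at this
    exact this
  have hunion : c.law z (A ∪ A') ≤ c.P z y := by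
    rw [← c.law_start_and_step z y, ← measure_toMeasurable A]
    exact measure_mono (Set.union_subset (subset_toMeasurable _ _) hsub)
  set R : I → ℝ≥0∞ := fun w => if w = y ∨ w = y' then 0 else c.P z w with hR
  have hcover : {ω : ℕ → I | ω 0 = z} ⊆
      (A ∪ A') ∪ ⋃ w, {ω | (ω 0 = z ∧ ω 1 = w) ∧ ¬ (w = y ∨ w = y')} := by
    intro ω hω
    by_cases hw : ω 1 = y ∨ ω 1 = y'
    · exact Or.inl (hw.imp (fun h => ⟨hω, h⟩) (fun h => ⟨hω, h⟩))
    · exact Or.inr (Set.mem_iUnion.2 ⟨ω 1, ⟨hω, rfl⟩, hw⟩)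
  have hle : 1 ≤ c.P z y + ∑' w, R w := by
    calc 1 = c.law z {ω | ω 0 = z} := (c.law_start z).symm
      _ ≤ _ := (measure_mono hcover).trans (measure_union_le _ _)
      _ ≤ c.P z y + ∑' w, R w := by
        refine add_le_add hunion ((measure_iUnion_le _).trans (ENNReal.tsum_le_tsum fun w => ?_))
        by_cases hw : w = y ∨ w = y'
        · simp [hw]
        · simp [hR, hw, c.law_start_and_step]
  have hsum : c.P z y + c.P z y' + ∑' w, R w = 1 := by
    rw [← c.P_row z, ← tsum_ite_eq y (fun w => c.P z w), ← tsum_ite_eq y' (fun w => c.P z w),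
      ← ENNReal.tsum_add, ← ENNReal.tsum_add]
    refine tsum_congr fun w => ?_
    by_cases h1 : w = y
    · subst h1; simp [hR, hne]
    · by_cases h2 : w = y' <;> simp [hR, h1, h2, hne.symm]
  have hfin : c.P z y + ∑' w, R w ≠ ⊤ := by
    refine ne_top_of_le_ne_top ENNReal.one_ne_top (hsum ▸ ?_)
    gcongr
    exact le_self_add
  have : c.P z y + ∑' w, R w + c.P z y' ≤ c.P z y + ∑' w, R w + 0 := by
    rw [add_right_comm, hsum, add_zero]
    exact hle
  simpa using (ENNReal.add_le_add_iff_left hfin).1 this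

/-- The cylinder formula forces the measurable structure on the state space to be discrete. -/
lemma discreteMeasurableSpace [Countable I] (c : TreeChain I) : DiscreteMeasurableSpace I := by
  have : MeasurableSpace.SeparatesPoints I := by
    refine ⟨fun y y' h => ?_⟩
    by_contra hne
    have h' : ∀ s : Set I, MeasurableSet s → y' ∈ s → y ∈ s := fun s hs hy' => by
      by_contra hy
      exact h _ hs.compl hy hy'
    by_cases hy : y = c.root
    · exact c.lam_pos y' (fun h' => hne (hy.trans h'.symm))
        (c.P_eq_zero_of_indistinguishable hne h _)
    · exact c.lam_pos y hy (c.P_eq_zero_of_indistinguishable (Ne.symm hne) h' _)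
  have := MeasurableSpace.measurableSingletonClass_of_countablySeparated (α := I)
  infer_instance

open Classical in
/-- The probability, started at `z`, of avoiding `x` up to and including time `n`. -/
def survival (x : I) : ℕ → I → ℝ≥0∞
  | 0, z => if z = x then 0 else 1
  | n + 1, z => if z = x then 0 else ∑' w, c.P z w * survival x n w

@[simp] lemma survival_self (x : I) (n : ℕ) : c.survival x n x = 0 := by
  cases n <;> simp [survival]

lemma survival_zero {x z : I} (h : z ≠ x) : c.survival x 0 z = 1 := by
  simp [survival, h]

lemma survival_succ {x z : I} (h : z ≠ x) (n : ℕ) :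
    c.survival x (n + 1) z = ∑' w, c.P z w * c.survival x n w := by
  simp [survival, h]

lemma survival_le_one (x : I) (n : ℕ) (z : I) : c.survival x n z ≤ 1 := by
  induction n generalizing z with
  | zero => by_cases h : z = x <;> simp [survival, h]
  | succ n ih =>
    by_cases h : z = x
    · simp [h]
    · rw [c.survival_succ h, ← c.P_row z]
      exact ENNReal.tsum_le_tsum fun w => mul_le_of_le_one_right' (ih w)

lemma measurableSet_forall_coord [DiscreteMeasurableSpace I] (n : ℕ) (k : ℕ → ℕ)
    (s : ℕ → Set I) : MeasurableSet {ω : ℕ → I | ∀ j ≤ n, ω (k j) ∈ s j} := by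
  have : {ω : ℕ → I | ∀ j ≤ n, ω (k j) ∈ s j} =
      ⋂ j, ⋂ (_ : j ≤ n), (fun ω : ℕ → I => ω (k j)) ⁻¹' s j := by
    ext ω
    simp
  rw [this]
  exact MeasurableSet.iInter fun j => MeasurableSet.iInter fun _ =>
    measurable_pi_apply (k j) MeasurableSet.of_discrete

lemma law_prefix_survival [Countable I] [DiscreteMeasurableSpace I] (x : I) (m n : ℕ)
    (γ : ℕ → I) :
    c.law (γ 0) {ω | (∀ i ≤ n, ω i = γ i) ∧ ∀ j ≤ m, ω (n + j) ≠ x} =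
      (∏ i ∈ Finset.range n, c.P (γ i) (γ (i + 1))) * c.survival x m (γ n) := by
  classical
  induction m generalizing n γ with
  | zero =>
    by_cases hx : γ n = x
    · rw [hx, survival_self, mul_zero]
      convert measure_empty (μ := c.law (γ 0))
      ext ω
      simp only [Set.mem_ofPred_eq, Set.mem_empty_iff_false, iff_false]
      rintro ⟨h1, h2⟩
      exact h2 0 le_rfl ((h1 n le_rfl).trans hx)
    · rw [c.survival_zero hx, mul_one, ← c.law_cyl (γ 0) n γ rfl]
      congr 1
      ext ω
      simp only [Set.mem_ofPred_eq, nonpos_iff_eq_zero, forall_eq, add_zero, and_iff_left_iff_imp]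
      intro h
      rwa [h n le_rfl]
  | succ m ih =>
    by_cases hx : γ n = x
    · rw [hx, survival_self, mul_zero]
      convert measure_empty (μ := c.law (γ 0))
      ext ω
      simp only [Set.mem_ofPred_eq, Set.mem_empty_iff_false, iff_false]
      rintro ⟨h1, h2⟩
      exact h2 0 (Nat.zero_le _) ((h1 n le_rfl).trans hx)
    · set D : I → Set (ℕ → I) := fun w =>
        {ω | (∀ i ≤ n + 1, ω i = Function.update γ (n + 1) w i) ∧
          ∀ j ≤ m, ω (n + 1 + j) ≠ x} with hD
      have hset : {ω : ℕ → I | (∀ i ≤ n, ω i = γ i) ∧ ∀ j ≤ m + 1, ω (n + j) ≠ x} =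
          ⋃ w, D w := by
        ext ω
        simp only [hD, Set.mem_ofPred_eq, Set.mem_iUnion]
        constructor
        · rintro ⟨h1, h2⟩
          refine ⟨ω (n + 1), fun i hi => ?_, fun j hj => ?_⟩
          · rcases eq_or_ne i (n + 1) with rfl | hi'
            · simp
            · rw [Function.update_of_ne hi']
              exact h1 i (by omega)
          · have := h2 (j + 1) (by omega)
            rwa [show n + (j + 1) = n + 1 + j by omega] at this
        · rintro ⟨w, h1, h2⟩
          have h1' : ∀ i ≤ n, ω i = γ i := fun i hi => by
            have := h1 i (by omega)
            rwa [Function.update_of_ne (by omega)] at this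
          refine ⟨h1', fun j hj => ?_⟩
          rcases Nat.eq_zero_or_pos j with rfl | hj'
          · rw [add_zero, h1' n le_rfl]
            exact hx
          · have := h2 (j - 1) (by omega)
            rwa [show n + 1 + (j - 1) = n + j by omega] at this
      rw [hset, measure_iUnion]
      · rw [c.survival_succ hx, ← ENNReal.tsum_mul_left]
        refine tsum_congr fun w => ?_
        have := ih (n + 1) (Function.update γ (n + 1) w)
        rw [Function.update_of_ne (by omega)] at this
        rw [this, Finset.prod_range_succ, Function.update_self, Function.update_of_ne (by omega),
          mul_assoc]
        congr 1
        refine Finset.prod_congr rfl fun i hi => ?_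
        rw [Finset.mem_range] at hi
        rw [Function.update_of_ne (by omega), Function.update_of_ne (by omega)]
      · intro w w' hww
        refine Set.disjoint_left.2 fun ω h h' => hww ?_
        have h1 := h.1 (n + 1) le_rfl
        have h2 := h'.1 (n + 1) le_rfl
        rw [Function.update_self] at h1 h2
        exact h1.symm.trans h2
      · intro w
        exact (measurableSet_forall_coord _ id fun i => {Function.update γ (n + 1) w i}).inter
          (measurableSet_forall_coord m (fun j => n + 1 + j) fun _ => {x}ᶜ)

lemma measurableSet_avoid [DiscreteMeasurableSpace I] (x : I) (n : ℕ) :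
    MeasurableSet {ω : ℕ → I | ∀ j ≤ n, ω j ≠ x} :=
  measurableSet_forall_coord n id fun _ => {x}ᶜ

lemma law_avoid [Countable I] [DiscreteMeasurableSpace I] (x z : I) (n : ℕ) :
    c.law z {ω | ∀ j ≤ n, ω j ≠ x} = c.survival x n z := by
  have := c.law_prob z
  have h := c.law_prefix_survival x n 0 (fun _ => z)
  simp only [nonpos_iff_eq_zero, forall_eq, zero_add, Finset.range_zero, Finset.prod_empty,
    one_mul] at h
  rw [← h]
  have h0 : ∀ᵐ ω ∂(c.law z), ω 0 = z := by
    rw [ae_iff_prob_eq_one]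
    · exact c.law_start z
    · exact (Measurable.of_discrete (f := fun i : I => i = z)).comp (measurable_pi_apply 0)
  refine measure_congr ?_
  filter_upwards [h0] with ω hω
  exact propext ⟨fun h => ⟨hω, h⟩, fun h => h.2⟩

end TreeChain

lemma hitTime_eq_tsum {I : Type*} (x : I) (ω : ℕ → I) (f : ℕ → ℝ≥0∞) (g : ℝ≥0∞ → ℝ≥0∞)
    (hf : ∀ n, 1 ≤ f n) (hg : ∀ N : ℕ, g N = ∑ n ∈ Finset.range N, f n) (hg' : g ⊤ = ⊤) :
    g (hitTime x ω) = ∑' n, {ω : ℕ → I | ∀ j ≤ n, ω j ≠ x}.indicator (fun _ => f n) ω := by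
  classical
  by_cases h : ∃ t, ω t = x
  · have hN : hitTime x ω = (Nat.find h : ℕ) := by
      refine le_antisymm (iInf₂_le (Nat.find h) (Nat.find_spec h)) (le_iInf₂ fun t ht => ?_)
      exact_mod_cast Nat.find_min' h ht
    rw [hN, hg, tsum_eq_sum (s := Finset.range (Nat.find h))]
    · refine Finset.sum_congr rfl fun n hn => ?_
      rw [Set.indicator_of_mem]
      intro j hj
      exact Nat.find_min h (hj.trans_lt (Finset.mem_range.1 hn))
    · intro n hn
      rw [Set.indicator_of_notMem]
      intro hmem
      exact hmem _ (not_lt.1 fun h' => hn (Finset.mem_range.2 h')) (Nat.find_spec h)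
  · push Not at h
    have hN : hitTime x ω = ⊤ := by simp [hitTime, h]
    rw [hN, hg', eq_comm, eq_top_iff]
    calc (⊤ : ℝ≥0∞) = ∑' _ : ℕ, 1 := by simp
      _ ≤ _ := ENNReal.tsum_le_tsum fun n => by
        rw [Set.indicator_of_mem]
        · exact hf n
        · exact fun j _ => h j

lemma measurable_hitTime {I : Type*} [MeasurableSpace I] [DiscreteMeasurableSpace I] (x : I) :
    Measurable (hitTime x : (ℕ → I) → ℝ≥0∞) := by
  have : (hitTime x : (ℕ → I) → ℝ≥0∞) =
      fun ω => ∑' n, {ω : ℕ → I | ∀ j ≤ n, ω j ≠ x}.indicator (fun _ => 1) ω := by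
    ext ω
    exact hitTime_eq_tsum x ω (fun _ => 1) id (fun _ => le_rfl) (by simp) rfl
  rw [this]
  exact Measurable.tsum fun n => measurable_const.indicator (TreeChain.measurableSet_avoid x n)

namespace TreeChain

variable {I : Type*} [MeasurableSpace I] (c : TreeChain I)

lemma ET2_add_ET [Countable I] [DiscreteMeasurableSpace I] (z x : I) :
    c.ET2 z x + c.ET z x = ∑' n : ℕ, 2 * ((n : ℝ≥0∞) + 1) * c.survival x n z := by
  rw [ET2, ET, ← lintegral_add_right _ (measurable_hitTime x)]
  have h : ∀ ω : ℕ → I, hitTime x ω ^ 2 + hitTime x ω = ∑' n : ℕ,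
      {ω : ℕ → I | ∀ j ≤ n, ω j ≠ x}.indicator (fun _ => 2 * ((n : ℝ≥0∞) + 1)) ω := by
    intro ω
    refine hitTime_eq_tsum x ω (fun n => 2 * ((n : ℝ≥0∞) + 1)) (fun T => T ^ 2 + T) ?_ ?_ (by simp)
    · intro n
      exact_mod_cast (by omega : 1 ≤ 2 * (n + 1))
    · intro N
      induction N with
      | zero => simp
      | succ N ih => rw [Finset.sum_range_succ, ← ih]; push_cast; ring
  simp_rw [h]
  rw [lintegral_tsum fun n =>
    (measurable_const.indicator (measurableSet_avoid x n)).aemeasurable]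
  refine tsum_congr fun n => ?_
  rw [lintegral_indicator_const (measurableSet_avoid x n), c.law_avoid]

end TreeChain

lemma ENNReal.tendsto_tsum_zero_of_dominated {ι : Type*} (F : ℕ → ι → ℝ≥0∞) (bound : ι → ℝ≥0∞)
    (hF : ∀ n i, F n i ≤ bound i) (hb : ∑' i, bound i ≠ ⊤)
    (hlim : ∀ i, Tendsto (fun n => F n i) atTop (𝓝 0)) :
    Tendsto (fun n => ∑' i, F n i) atTop (𝓝 0) := by
  let _ : MeasurableSpace ι := ⊤
  have h := tendsto_lintegral_of_dominated_convergence (μ := Measure.count) (F := F)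
    (f := fun _ => 0) bound (fun _ => Measurable.of_discrete)
    (fun n => Eventually.of_forall (hF n)) (by rwa [lintegral_count]) (Eventually.of_forall hlim)
  simpa [lintegral_count] using h

lemma ENNReal.tsum_succ_mul_eq_tsum_tsum_add (a : ℕ → ℝ≥0∞) :
    ∑' n : ℕ, ((n : ℝ≥0∞) + 1) * a n = ∑' k, ∑' n, a (k + n) := by
  rw [← ENNReal.tsum_prod (f := fun k n => a (k + n)),
    ← (Finset.HasAntidiagonal.sigmaAntidiagonalEquivProd (A := ℕ)).tsum_eq, ENNReal.tsum_sigma']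
  refine tsum_congr fun n => ?_
  rw [tsum_fintype]
  calc ((n : ℝ≥0∞) + 1) * a n = ∑ _p : Finset.HasAntidiagonal.antidiagonal n, a n := by simp
    _ = _ := Finset.sum_congr rfl fun p _ => by
      have := Finset.HasAntidiagonal.mem_antidiagonal.1 p.2
      simp [this]

namespace TreeChain

variable {I : Type*} [MeasurableSpace I] (c : TreeChain I)

lemma invm_ne_top (x : I) : c.invm x ≠ ⊤ :=
  ne_top_of_le_ne_top (c.invm_sum ▸ ENNReal.one_ne_top) (ENNReal.le_tsum x)

lemma P_ne_top (x y : I) : c.P x y ≠ ⊤ :=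
  ne_top_of_le_ne_top (c.P_row x ▸ ENNReal.one_ne_top) (ENNReal.le_tsum y)

lemma P_symm_ne_zero {x y : I} (h : c.P x y ≠ 0) : c.P y x ≠ 0 := by
  intro h'
  have := c.invm_rev x y
  rw [h', mul_zero, mul_eq_zero] at this
  exact this.elim (c.invm_pos x) h

/-- The chain can leave `S` only by a jump from `s` to `t`. -/
structure SingleExit (S : Set I) (s t : I) : Prop where
  mem : s ∈ S
  notMem : t ∉ S
  exit : ∀ w ∈ S, ∀ z ∉ S, c.P w z ≠ 0 → w = s ∧ z = t

/-- The mass of starting points in `S`, under the invariant measure, whose chain avoids `x`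
up to and including time `n`. -/
def survivalMass (x : I) (n : ℕ) (S : Set I) : ℝ≥0∞ :=
  ∑' z, S.indicator (fun z => c.invm z * c.survival x n z) z

variable {c}

open Classical in
lemma SingleExit.tsum_indicator_of_mem {S : Set I} {s t w : I} (h : c.SingleExit S s t)
    (hw : w ∈ S) : ∑' z, S.indicator (c.P w) z + (if w = s then c.P s t else 0) = 1 := by
  have h2 : ∑' z, Sᶜ.indicator (c.P w) z = if w = s then c.P s t else 0 := by
    rw [← tsum_ite_eq t (fun _ => if w = s then c.P s t else 0)]
    refine tsum_congr fun z => ?_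
    by_cases hz : z ∈ S
    · have : z ≠ t := fun h' => h.notMem (h' ▸ hz)
      simp [hz, this]
    · rw [Set.indicator_of_mem (by exact hz)]
      by_cases hP : c.P w z = 0
      · rw [hP]
        by_cases h1 : z = t
        · by_cases h2 : w = s
          · subst h1 h2
            simp [hP]
          · simp [h2]
        · simp [h1]
      · obtain ⟨rfl, rfl⟩ := h.exit w hw z hz hP
        simp
  rw [← h2, ← ENNReal.tsum_add, ← c.P_row w]
  refine tsum_congr fun z => ?_
  by_cases hz : z ∈ S <;> simp [hz]

open Classical in
lemma SingleExit.tsum_indicator_of_notMem {S : Set I} {s t w : I} (h : c.SingleExit S s t)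
    (hw : w ∉ S) : ∑' z, S.indicator (c.P w) z = if w = t then c.P t s else 0 := by
  rw [← tsum_ite_eq s (fun _ => if w = t then c.P t s else 0)]
  refine tsum_congr fun z => ?_
  by_cases hz : z ∈ S
  · rw [Set.indicator_of_mem hz]
    by_cases hP : c.P w z = 0
    · rw [hP]
      by_cases h1 : z = s
      · by_cases h2 : w = t
        · subst h1 h2
          simp [hP]
        · simp [h2]
      · simp [h1]
    · obtain ⟨rfl, rfl⟩ := h.exit z hz w hw (c.P_symm_ne_zero hP)
      simp
  · have : z ≠ s := fun h' => hz (h' ▸ h.mem)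
    simp [hz, this]

lemma SingleExit.survivalMass_succ {S : Set I} {s t x : I} (h : c.SingleExit S s t)
    (hx : x ∉ S) (n : ℕ) :
    c.survivalMass x (n + 1) S + c.invm s * c.P s t * c.survival x n s =
      c.survivalMass x n S + c.invm s * c.P s t * c.survival x n t := by
  classical
  have h1 : c.survivalMass x (n + 1) S =
      ∑' w, c.invm w * c.survival x n w * ∑' z, S.indicator (c.P w) z := by
    calc c.survivalMass x (n + 1) S
        = ∑' z, ∑' w, c.invm w * c.survival x n w * S.indicator (c.P w) z := by
          refine tsum_congr fun z => ?_
          by_cases hz : z ∈ S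
          · rw [Set.indicator_of_mem hz, c.survival_succ (show z ≠ x from fun h' => hx (h' ▸ hz)),
              ← ENNReal.tsum_mul_left]
            refine tsum_congr fun w => ?_
            rw [Set.indicator_of_mem hz, ← mul_assoc, c.invm_rev z w]
            ring
          · simp [hz]
      _ = _ := by
          rw [ENNReal.tsum_comm]
          exact tsum_congr fun w => ENNReal.tsum_mul_left
  rw [h1, survivalMass, ← tsum_ite_eq s (fun _ => c.invm s * c.P s t * c.survival x n s),
    ← tsum_ite_eq t (fun _ => c.invm s * c.P s t * c.survival x n t), ← ENNReal.tsum_add,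
    ← ENNReal.tsum_add]
  refine tsum_congr fun w => ?_
  by_cases hw : w ∈ S
  · have hwt : w ≠ t := fun h' => h.notMem (h' ▸ hw)
    rw [Set.indicator_of_mem hw, if_neg hwt, add_zero]
    conv_rhs => rw [← mul_one (c.invm w * c.survival x n w), ← h.tsum_indicator_of_mem hw, mul_add]
    congr 1
    by_cases hws : w = s
    · subst hws
      simp only [if_true]
      ring
    · simp [hws]
  · have hws : w ≠ s := fun h' => hw (h' ▸ h.mem)
    rw [h.tsum_indicator_of_notMem hw, Set.indicator_of_notMem hw, if_neg hws, add_zero, zero_add]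
    by_cases hwt : w = t
    · subst hwt
      simp only [if_true]
      rw [c.invm_rev s w]
      ring
    · simp [hwt]

lemma SingleExit.survivalMass_add {S : Set I} {s t x : I} (h : c.SingleExit S s t)
    (hx : x ∉ S) (k N : ℕ) :
    c.survivalMass x (k + N) S +
        ∑ n ∈ Finset.range N, c.invm s * c.P s t * c.survival x (k + n) s =
      c.survivalMass x k S +
        ∑ n ∈ Finset.range N, c.invm s * c.P s t * c.survival x (k + n) t := by
  induction N with
  | zero => simp
  | succ N ih =>
    rw [Finset.sum_range_succ, Finset.sum_range_succ, ← add_assoc (c.survivalMass x k S), ← ih,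
      add_right_comm (c.survivalMass x (k + N) S), ← h.survivalMass_succ hx, ← add_assoc k N 1]
    ring

lemma SingleExit.survivalMass_add_tsum {S : Set I} {s t x : I} (h : c.SingleExit S s t)
    (hx : x ∉ S) (hlim : ∀ z ∈ S, Tendsto (fun n => c.survival x n z) atTop (𝓝 0)) (k : ℕ) :
    c.invm s * c.P s t * ∑' n, c.survival x (k + n) s =
      c.survivalMass x k S + c.invm s * c.P s t * ∑' n, c.survival x (k + n) t := by
  have hm : Tendsto (fun n => c.survivalMass x n S) atTop (𝓝 0) := by
    refine ENNReal.tendsto_tsum_zero_of_dominated _ c.invm (fun n z => ?_)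
      (c.invm_sum ▸ ENNReal.one_ne_top) fun z => ?_
    · refine (Set.indicator_le_self _ _ _).trans ?_
      exact mul_le_of_le_one_right' (c.survival_le_one x n z)
    · by_cases hz : z ∈ S
      · simp only [Set.indicator_of_mem hz]
        simpa using ENNReal.Tendsto.const_mul (hlim z hz) (Or.inr (c.invm_ne_top z))
      · simp [hz]
  have h1 := (hm.comp (tendsto_add_atTop_nat k)).add
    (ENNReal.tendsto_nat_tsum fun n => c.invm s * c.P s t * c.survival x (k + n) s)
  have h2 := (tendsto_const_nhds (x := c.survivalMass x k S)).add
    (ENNReal.tendsto_nat_tsum fun n => c.invm s * c.P s t * c.survival x (k + n) t)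
  have := tendsto_nhds_unique (h1.congr fun N => ?_) h2
  · rwa [ENNReal.tsum_mul_left, ENNReal.tsum_mul_left, zero_add] at this
  · rw [← h.survivalMass_add hx k N, add_comm k N]
    rfl

lemma survivalMass_zero {S : Set I} {x : I} (hx : x ∉ S) :
    c.survivalMass x 0 S = c.piSet S := by
  rw [piSet, tsum_subtype, survivalMass]
  refine tsum_congr fun z => ?_
  by_cases hz : z ∈ S
  · simp [hz, c.survival_zero (fun h => hx (h ▸ hz) : z ≠ x)]
  · simp [hz]

lemma piSet_le_one (S : Set I) : c.piSet S ≤ 1 := by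
  rw [piSet, tsum_subtype, ← c.invm_sum]
  exact ENNReal.tsum_le_tsum fun z => Set.indicator_le_self _ _ _

lemma tendsto_survival_of_tendsto {x z w : I} (hz : z ≠ x) (hP : c.P z w ≠ 0)
    (h : Tendsto (fun n => c.survival x n z) atTop (𝓝 0)) :
    Tendsto (fun n => c.survival x n w) atTop (𝓝 0) := by
  have h1 : Tendsto (fun n => (c.P z w)⁻¹ * c.survival x (n + 1) z) atTop (𝓝 0) := by
    simpa using ENNReal.Tendsto.const_mul (h.comp (tendsto_add_atTop_nat 1))
      (Or.inr (ENNReal.inv_ne_top.2 hP))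
  refine tendsto_of_tendsto_of_tendsto_of_le_of_le tendsto_const_nhds h1 (fun _ => zero_le) ?_
  intro n
  simp only [c.survival_succ hz]
  calc c.survival x n w = (c.P z w)⁻¹ * (c.P z w * c.survival x n w) := by
        rw [← mul_assoc, ENNReal.inv_mul_cancel hP (c.P_ne_top z w), one_mul]
    _ ≤ _ := by
        gcongr
        exact ENNReal.le_tsum w

lemma SingleExit.tendsto_survival {S : Set I} {s x : I} (h : c.SingleExit S s x)
    (hP : c.P s x ≠ 0) : Tendsto (fun n => c.survival x n s) atTop (𝓝 0) := by
  refine ENNReal.tendsto_atTop_zero_of_tsum_ne_top fun htop => ?_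
  have hle : c.invm s * c.P s x * ∑' n, c.survival x n s ≤ 1 := by
    rw [← ENNReal.tsum_mul_left]
    refine le_of_tendsto' (ENNReal.tendsto_nat_tsum _) fun N => ?_
    have := h.survivalMass_add h.notMem 0 N
    simp only [zero_add, survival_self, mul_zero, Finset.sum_const_zero, add_zero] at this
    exact le_add_self.trans (this.le.trans ((survivalMass_zero h.notMem).le.trans
      (piSet_le_one S)))
  rw [htop, ENNReal.mul_top (mul_ne_zero (c.invm_pos s) hP)] at hle
  simp at hle

end TreeChain

namespace TreeChain

variable {I : Type*} [MeasurableSpace I] {c : TreeChain I}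

lemma mem_branch_self (x : I) : x ∈ c.branch x := ⟨0, rfl⟩

lemma mem_branch_iff {y w : I} : y ∈ c.branch w ↔ y = w ∨ c.par y ∈ c.branch w := by
  constructor
  · rintro ⟨n, hn⟩
    cases n with
    | zero => exact Or.inl hn
    | succ n => exact Or.inr ⟨n, hn⟩
  · rintro (rfl | ⟨n, hn⟩)
    · exact mem_branch_self _
    · exact ⟨n + 1, hn⟩

lemma mem_branch_trans {x y z : I} (h : x ∈ c.branch y) (h' : y ∈ c.branch z) :
    x ∈ c.branch z := by
  obtain ⟨n, rfl⟩ := h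
  obtain ⟨m, rfl⟩ := h'
  exact ⟨m + n, Function.iterate_add_apply _ _ _ _⟩

lemma mem_branch_or_mem_branch {y a b : I} (ha : y ∈ c.branch a) (hb : y ∈ c.branch b) :
    a ∈ c.branch b ∨ b ∈ c.branch a := by
  obtain ⟨n, rfl⟩ := ha
  obtain ⟨m, rfl⟩ := hb
  rcases le_total n m with h | h
  · refine Or.inl ⟨m - n, ?_⟩
    rw [← Function.iterate_add_apply, Nat.sub_add_cancel h]
  · refine Or.inr ⟨n - m, ?_⟩
    rw [← Function.iterate_add_apply, Nat.sub_add_cancel h]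

lemma depth_iterate_par (x : I) (i : ℕ) : c.depth (c.par^[i] x) = c.depth x - i := by
  induction i with
  | zero => rfl
  | succ i ih =>
    rw [Function.iterate_succ_apply']
    by_cases h : c.par^[i] x = c.root
    · rw [h, c.par_root, ← h, ih]
      rw [h, c.depth_root] at ih
      omega
    · have := c.depth_par _ h
      omega

lemma iterate_par_eq_root_iff (x : I) (i : ℕ) : c.par^[i] x = c.root ↔ c.depth x ≤ i := by
  constructor
  · intro h
    have := c.depth_iterate_par x i
    rw [h, c.depth_root] at this
    omega
  · intro h
    refine c.depth_eq_zero _ ?_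
    rw [depth_iterate_par]
    omega

lemma mem_branch_root (x : I) : x ∈ c.branch c.root :=
  ⟨c.depth x, (iterate_par_eq_root_iff x _).2 le_rfl⟩

lemma depth_le_of_mem_branch {x y : I} (h : y ∈ c.branch x) : c.depth x ≤ c.depth y := by
  obtain ⟨n, rfl⟩ := h
  rw [depth_iterate_par]
  exact Nat.sub_le _ _

lemma par_notMem_branch {x : I} (hx : x ≠ c.root) : c.par x ∉ c.branch x := by
  intro h
  have h1 := depth_le_of_mem_branch h
  have h2 := c.depth_par x hx
  omega

lemma par_notMem_branch_of_notMem {x y : I} (h : y ∉ c.branch x) : c.par y ∉ c.branch x :=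
  fun h' => h (mem_branch_iff.2 (Or.inr h'))

lemma mem_pathToRoot_iff {x b : I} : b ∈ c.pathToRoot x ↔ b ≠ c.root ∧ x ∈ c.branch b := by
  constructor
  · rintro ⟨i, hi, rfl⟩
    exact ⟨fun h => absurd ((iterate_par_eq_root_iff x i).1 h) (by omega), i, rfl⟩
  · rintro ⟨h, n, rfl⟩
    exact ⟨n, not_le.1 fun h' => h ((iterate_par_eq_root_iff x n).2 h'), rfl⟩

lemma mem_Cset_zero_iff {x y : I} : y ∈ c.Cset x 0 ↔ y ∉ c.branch x ∧ x ∉ c.branch y := by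
  constructor
  · rintro ⟨l, hl, hld, ch, ⟨hr, hpar⟩, hne, hy⟩
    have hdch := c.depth_par ch hr
    rw [hpar, depth_iterate_par] at hdch
    have hxch : x ∉ c.branch ch := by
      rintro ⟨j, rfl⟩
      rw [depth_iterate_par] at hdch
      exact hne (by rw [show j = l - 1 by omega])
    have hchx : ch ∉ c.branch x := by
      intro h
      rcases mem_branch_iff.1 h with rfl | h
      · exact hxch (mem_branch_self _)
      · have := depth_le_of_mem_branch h
        rw [hpar, depth_iterate_par] at this
        omega
    exact ⟨fun h => (mem_branch_or_mem_branch hy h).elim hchx hxch,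
      fun h => hxch (mem_branch_trans h hy)⟩
  · rintro ⟨hyx, hxy⟩
    induction hn : c.depth y generalizing y with
    | zero =>
      rw [c.depth_eq_zero y hn] at hxy
      exact absurd (mem_branch_root x) hxy
    | succ n ih =>
      have hy : y ≠ c.root := fun h => hxy (h ▸ mem_branch_root x)
      by_cases hp : x ∈ c.branch (c.par y)
      · obtain ⟨l, hl, hl'⟩ : ∃ l ≤ c.depth x, c.par^[l] x = c.par y := by
          obtain ⟨l, hl⟩ := hp
          rcases le_total l (c.depth x) with h | h
          · exact ⟨l, h, hl⟩
          · exact ⟨_, le_rfl, ((iterate_par_eq_root_iff x _).2 le_rfl).trans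
              (((iterate_par_eq_root_iff x l).2 h).symm.trans hl)⟩
        refine ⟨l, ?_, hl, y, ⟨hy, hl'.symm⟩, fun h => hxy ⟨_, h.symm⟩, mem_branch_self y⟩
        rcases Nat.eq_zero_or_pos l with rfl | h
        · exact absurd ⟨1, hl'.symm⟩ hyx
        · omega
      · have hd := c.depth_par y hy
        obtain ⟨l, h1, h2, ch, h3, h4, h5⟩ :=
          ih (par_notMem_branch_of_notMem hyx) hp (by omega)
        exact ⟨l, h1, h2, ch, h3, h4, mem_branch_iff.2 (Or.inr h5)⟩

lemma singleExit_branch {z : I} (hz : z ≠ c.root) :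
    c.SingleExit (c.branch z) z (c.par z) := by
  refine ⟨mem_branch_self z, par_notMem_branch hz, fun w hw v hv hP => ?_⟩
  rcases c.P_support w v hP with rfl | rfl | rfl
  · exact absurd hw hv
  · rcases mem_branch_iff.1 hw with rfl | h
    · exact ⟨rfl, rfl⟩
    · exact absurd h hv
  · exact absurd (mem_branch_iff.2 (Or.inr hw)) hv

lemma singleExit_compl_branch {z : I} (hz : z ≠ c.root) :
    c.SingleExit (c.branch z)ᶜ (c.par z) z := by
  refine ⟨par_notMem_branch hz, not_not.2 (mem_branch_self z), fun w hw v hv hP => ?_⟩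
  have hv := not_not.1 hv
  rcases c.P_support w v hP with rfl | rfl | rfl
  · exact absurd hv hw
  · exact absurd (mem_branch_iff.2 (Or.inr hv)) hw
  · rcases mem_branch_iff.1 hv with rfl | h
    · exact ⟨rfl, rfl⟩
    · exact absurd h hw

lemma tendsto_survival {x z : I} (hx : x ≠ c.root) (hz : z ∉ c.branch x) :
    Tendsto (fun n => c.survival x n z) atTop (𝓝 0) := by
  have hpath : ∀ i, Tendsto (fun n => c.survival x n (c.par^[i + 1] x)) atTop (𝓝 0) := by
    intro i
    induction i with
    | zero => exact (singleExit_compl_branch hx).tendsto_survival (c.lam_pos x hx)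
    | succ i ih =>
      rw [Function.iterate_succ_apply' _ (i + 1)]
      by_cases h : c.par^[i + 1] x = c.root
      · rw [h, c.par_root, ← h]
        exact ih
      · refine tendsto_survival_of_tendsto (fun h' => ?_) (c.mu_pos _ h) ih
        exact par_notMem_branch hx ⟨i, h'⟩
  induction hn : c.depth z generalizing z with
  | zero =>
    rw [c.depth_eq_zero z hn, ← (iterate_par_eq_root_iff x (c.depth x + 1)).2 (Nat.le_succ _)]
    exact hpath _
  | succ n ih =>
    have hzr : z ≠ c.root := fun h => by simp [h, c.depth_root] at hn
    have hp := par_notMem_branch_of_notMem hz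
    have hd := c.depth_par z hzr
    exact tendsto_survival_of_tendsto (fun h => hp (h ▸ mem_branch_self _)) (c.lam_pos z hzr)
      (ih hp (by omega))

lemma mu_mul_invm_ne_zero {b : I} (hb : b ≠ c.root) : c.mu b * c.invm b ≠ 0 :=
  mul_ne_zero (c.mu_pos b hb) (c.invm_pos b)

lemma mu_mul_invm_ne_top (b : I) : c.mu b * c.invm b ≠ ⊤ :=
  ENNReal.mul_ne_top (c.P_ne_top _ _) (c.invm_ne_top b)

lemma invm_par_mul_P (b : I) : c.invm (c.par b) * c.P (c.par b) b = c.mu b * c.invm b := by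
  rw [c.invm_rev, mul_comm, mu]

lemma eq_div_add_of_mul_eq {k a b m : ℝ≥0∞} (h0 : k ≠ 0) (ht : k ≠ ⊤)
    (h : k * a = m + k * b) : a = m / k + b := by
  rw [← ENNReal.mul_right_inj h0 ht, h, mul_add, ENNReal.mul_div_cancel h0 ht]

/-- The sum over time of the survival probabilities is the expected hitting time; crossing an
edge away from `x` adds the expected time to come back. -/
lemma tsum_survival_eq_of_mem_Cset {x z : I} (hx : x ≠ c.root) (hz : z ∈ c.Cset x 0) :
    ∑' n, c.survival x n z = c.piSet (c.branch z) / (c.mu z * c.invm z) +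
      ∑' n, c.survival x n (c.par z) := by
  obtain ⟨hzx, hxz⟩ := mem_Cset_zero_iff.1 hz
  have hzr : z ≠ c.root := fun h => hxz (h ▸ mem_branch_root x)
  have h := (singleExit_branch hzr).survivalMass_add_tsum hxz (fun w hw =>
    tendsto_survival hx fun hwx => (mem_branch_or_mem_branch hw hwx).elim hzx hxz) 0
  simp only [zero_add] at h
  rw [survivalMass_zero hxz, show c.invm z * c.P z (c.par z) = c.mu z * c.invm z from
    mul_comm _ _] at h
  exact eq_div_add_of_mul_eq (mu_mul_invm_ne_zero hzr) (mu_mul_invm_ne_top z) h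

lemma tsum_survival_par_of_mem_pathToRoot {x b : I} (hx : x ≠ c.root)
    (hb : b ∈ c.pathToRoot x) :
    ∑' n, c.survival x n (c.par b) = c.piSet (c.branch b)ᶜ / (c.mu b * c.invm b) +
      ∑' n, c.survival x n b := by
  obtain ⟨hbr, hxb⟩ := mem_pathToRoot_iff.1 hb
  have h := (singleExit_compl_branch hbr).survivalMass_add_tsum (not_not.2 hxb) (fun w hw =>
    tendsto_survival hx fun hwx => hw (mem_branch_trans hwx hxb)) 0
  simp only [zero_add] at h
  rw [survivalMass_zero (not_not.2 hxb), invm_par_mul_P] at h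
  exact eq_div_add_of_mul_eq (mu_mul_invm_ne_zero hbr) (mu_mul_invm_ne_top b) h

lemma tsum_branch_indicator {z : I} (hz : z ≠ c.root) (D : Set I) (e : I → ℝ≥0∞) :
    ∑' b : D, (c.branch (b : I)).indicator (fun _ => e b) z = D.indicator e z +
      ∑' b : D, (c.branch (b : I)).indicator (fun _ => e b) (c.par z) := by
  classical
  rw [tsum_subtype D fun b => (c.branch b).indicator (fun _ => e b) z,
    tsum_subtype D fun b => (c.branch b).indicator (fun _ => e b) (c.par z),
    ← tsum_ite_eq z (fun _ => D.indicator e z), ← ENNReal.tsum_add]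
  refine tsum_congr fun b => ?_
  by_cases hb : b ∈ D
  · by_cases hbz : b = z
    · subst hbz
      simp [hb, mem_branch_self, par_notMem_branch hz]
    · have : z ∈ c.branch b ↔ c.par z ∈ c.branch b := by
        rw [mem_branch_iff, or_iff_right (Ne.symm hbz)]
      by_cases h : c.par z ∈ c.branch b <;> simp [hb, hbz, this, h]
  · by_cases hbz : b = z
    · subst hbz
      simp [hb]
    · simp [hb, hbz]

lemma tsum_compl_branch_indicator {z : I} (hz : z ≠ c.root) (D : Set I) (e : I → ℝ≥0∞) :
    ∑' b : D, (c.branch (b : I))ᶜ.indicator (fun _ => e b) (c.par z) = D.indicator e z +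
      ∑' b : D, (c.branch (b : I))ᶜ.indicator (fun _ => e b) z := by
  classical
  rw [tsum_subtype D fun b => (c.branch b)ᶜ.indicator (fun _ => e b) z,
    tsum_subtype D fun b => (c.branch b)ᶜ.indicator (fun _ => e b) (c.par z),
    ← tsum_ite_eq z (fun _ => D.indicator e z), ← ENNReal.tsum_add]
  refine tsum_congr fun b => ?_
  by_cases hb : b ∈ D
  · by_cases hbz : b = z
    · subst hbz
      simp [hb, mem_branch_self, par_notMem_branch hz]
    · have : z ∈ c.branch b ↔ c.par z ∈ c.branch b := by
        rw [mem_branch_iff, or_iff_right (Ne.symm hbz)]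
      by_cases h : c.par z ∈ c.branch b <;> simp [hb, hbz, this, h]
  · by_cases hbz : b = z
    · subst hbz
      simp [hb]
    · simp [hb, hbz]

lemma tsum_survival_eq {x z : I} (hx : x ≠ c.root) (hz : z ∉ c.branch x ∨ x ∈ c.branch z) :
    ∑' n, c.survival x n z =
      ∑' b : c.Cset x 0, (c.branch (b : I)).indicator
        (fun _ => c.piSet (c.branch (b : I)) / (c.mu (b : I) * c.invm (b : I))) z +
      ∑' b : c.pathToRoot x, (c.branch (b : I))ᶜ.indicator
        (fun _ => c.piSet (c.branch (b : I))ᶜ / (c.mu (b : I) * c.invm (b : I))) z := by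
  set e : I → ℝ≥0∞ := fun b => c.piSet (c.branch b) / (c.mu b * c.invm b)
  set e' : I → ℝ≥0∞ := fun b => c.piSet (c.branch b)ᶜ / (c.mu b * c.invm b)
  have hpath : ∀ i ≤ c.depth x, ∑' n, c.survival x n (c.par^[i] x) =
      ∑' b : c.Cset x 0, (c.branch (b : I)).indicator (fun _ => e b) (c.par^[i] x) +
      ∑' b : c.pathToRoot x, (c.branch (b : I))ᶜ.indicator (fun _ => e' b) (c.par^[i] x) := by
    intro i hi
    induction i with
    | zero =>
      have h1 : ∀ b : c.Cset x 0, (c.branch (b : I)).indicator (fun _ => e b) x = 0 := fun b =>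
        Set.indicator_of_notMem (mem_Cset_zero_iff.1 b.2).2 _
      have h2 : ∀ b : c.pathToRoot x, (c.branch (b : I))ᶜ.indicator (fun _ => e' b) x = 0 :=
        fun b => Set.indicator_of_notMem (not_not.2 (mem_pathToRoot_iff.1 b.2).2) _
      simp [h1, h2]
    | succ i ih =>
      have hmem : c.par^[i] x ∈ c.pathToRoot x := ⟨i, hi, rfl⟩
      have hr := (mem_pathToRoot_iff.1 hmem).1
      have hC : c.par^[i] x ∉ c.Cset x 0 := fun h => (mem_Cset_zero_iff.1 h).2 ⟨i, rfl⟩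
      have h1 := tsum_branch_indicator hr (c.Cset x 0) e
      rw [Set.indicator_of_notMem hC, zero_add] at h1
      rw [Function.iterate_succ_apply', tsum_survival_par_of_mem_pathToRoot hx hmem,
        ih (by omega), tsum_compl_branch_indicator hr, Set.indicator_of_mem hmem, h1]
      ring
  have hanc : ∀ w, x ∈ c.branch w → ∑' n, c.survival x n w =
      ∑' b : c.Cset x 0, (c.branch (b : I)).indicator (fun _ => e b) w +
      ∑' b : c.pathToRoot x, (c.branch (b : I))ᶜ.indicator (fun _ => e' b) w := by
    intro w hw
    by_cases hwr : w = c.root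
    · rw [hwr, ← (iterate_par_eq_root_iff x _).2 le_rfl]
      exact hpath _ le_rfl
    · obtain ⟨i, hi, rfl⟩ := mem_pathToRoot_iff.2 ⟨hwr, hw⟩
      exact hpath i hi.le
  by_cases hxz : x ∈ c.branch z
  · exact hanc z hxz
  replace hz := hz.resolve_right hxz
  induction hn : c.depth z generalizing z with
  | zero =>
    rw [c.depth_eq_zero z hn] at hxz
    exact absurd (mem_branch_root x) hxz
  | succ n ih =>
    have hzr : z ≠ c.root := fun h => hxz (h ▸ mem_branch_root x)
    have hd := c.depth_par z hzr
    have hzC := mem_Cset_zero_iff.2 ⟨hz, hxz⟩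
    have hzP : z ∉ c.pathToRoot x := fun h => hxz (mem_pathToRoot_iff.1 h).2
    have h1 := tsum_compl_branch_indicator hzr (c.pathToRoot x) e'
    rw [Set.indicator_of_notMem hzP, zero_add] at h1
    change _ = ∑' b : c.Cset x 0, (c.branch (b : I)).indicator (fun _ => e b) z +
      ∑' b : c.pathToRoot x, (c.branch (b : I))ᶜ.indicator (fun _ => e' b) z
    rw [tsum_survival_eq_of_mem_Cset hx hzC, tsum_branch_indicator hzr,
      Set.indicator_of_mem hzC, ← h1, add_assoc]
    congr 1
    by_cases hp : x ∈ c.branch (c.par z)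
    · exact hanc _ hp
    · exact ih hp (par_notMem_branch_of_notMem hz) (by omega)

lemma tsum_indicator_invm_mul_tsum {A D : Set I} (S : I → Set I) (k : I → ℝ≥0∞)
    (hS : ∀ b ∈ D, S b ⊆ A) :
    ∑' z, A.indicator (fun z => c.invm z *
        ∑' b : D, (S b).indicator (fun _ => c.piSet (S b) / k b) z) z =
      ∑' b : D, c.piSet (S b) ^ 2 / k b := by
  calc _ = ∑' z, ∑' b : D, (S b).indicator c.invm z * (c.piSet (S b) / k b) := by
        refine tsum_congr fun z => ?_
        by_cases hz : z ∈ A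
        · rw [Set.indicator_of_mem hz, ← ENNReal.tsum_mul_left]
          refine tsum_congr fun b => ?_
          by_cases hb : z ∈ S b <;> simp [hb]
        · have : ∀ b : D, z ∉ S b := fun b hb => hz (hS b b.2 hb)
          simp [hz, this]
    _ = _ := by
        rw [ENNReal.tsum_comm]
        refine tsum_congr fun b => ?_
        rw [ENNReal.tsum_mul_right, ← tsum_subtype, ← piSet, sq, mul_div_assoc]

end TreeChain
/-- **Lemma (3.2), second moment parent → child**:
`E[(T^{p(x)}_x)²] = (2/(μ_x π(x)))·(Σ_{c∈C_x} π(B_c)²/(μ_c π(c))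
  + Σ_{b∈ℓ(x)} π(I∖B_b)²/(μ_b π(b))) − E[T^{p(x)}_x]`,
stated in the equivalent additive form; here `C_x = Cset x 0`. -/
theorem ET2_parent_child {I : Type*} [MeasurableSpace I] [Countable I]
    (c : TreeChain I) (x : I) (hx : x ≠ c.root) :
    c.ET2 (c.par x) x + c.ET (c.par x) x
      = 2 / (c.mu x * c.invm x) *
          ((∑' cc : c.Cset x 0,
              (c.piSet (c.branch (cc : I))) ^ 2 / (c.mu (cc : I) * c.invm (cc : I))) +
           ∑' b : c.pathToRoot x,
              (c.piSet ((c.branch (b : I))ᶜ)) ^ 2 / (c.mu (b : I) * c.invm (b : I))) := by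

  have := c.discreteMeasurableSpace
  have hcompl : x ∉ (c.branch x)ᶜ := not_not.2 (TreeChain.mem_branch_self x)
  have hk : ∀ k, c.mu x * c.invm x * ∑' n, c.survival x (k + n) (c.par x) =
      c.survivalMass x k (c.branch x)ᶜ := fun k => by
    simpa [TreeChain.invm_par_mul_P] using
      (TreeChain.singleExit_compl_branch hx).survivalMass_add_tsum hcompl
        (fun w hw => TreeChain.tendsto_survival hx hw) k
  have hmass : ∑' k, c.survivalMass x k (c.branch x)ᶜ =
      ∑' z, (c.branch x)ᶜ.indicator (fun z => c.invm z * ∑' k, c.survival x k z) z := by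
    simp only [TreeChain.survivalMass]
    rw [ENNReal.tsum_comm]
    refine tsum_congr fun z => ?_
    by_cases hz : z ∈ (c.branch x)ᶜ
    · simp only [Set.indicator_of_mem hz, ENNReal.tsum_mul_left]
    · simp only [Set.indicator_of_notMem hz, tsum_zero]
  have hC : ∀ b ∈ c.Cset x 0, c.branch b ⊆ (c.branch x)ᶜ := fun b hb z hzb hzx =>
    (TreeChain.mem_branch_or_mem_branch hzb hzx).elim (TreeChain.mem_Cset_zero_iff.1 hb).1
      (TreeChain.mem_Cset_zero_iff.1 hb).2
  have hP : ∀ b ∈ c.pathToRoot x, (c.branch b)ᶜ ⊆ (c.branch x)ᶜ := fun b hb z hzb hzx =>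
    hzb (TreeChain.mem_branch_trans hzx (TreeChain.mem_pathToRoot_iff.1 hb).2)
  rw [← TreeChain.tsum_indicator_invm_mul_tsum c.branch (fun b => c.mu b * c.invm b) hC,
    ← TreeChain.tsum_indicator_invm_mul_tsum (fun b => (c.branch b)ᶜ)
      (fun b => c.mu b * c.invm b) hP, ← ENNReal.tsum_add, c.ET2_add_ET]
  trans 2 / (c.mu x * c.invm x) *
    ∑' z, (c.branch x)ᶜ.indicator (fun z => c.invm z * ∑' k, c.survival x k z) z
  · rw [← hmass, ← tsum_congr hk, ENNReal.tsum_mul_left,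
      ← ENNReal.tsum_succ_mul_eq_tsum_tsum_add (fun n => c.survival x n (c.par x)), ← mul_assoc,
      ENNReal.div_mul_cancel (TreeChain.mu_mul_invm_ne_zero hx) (TreeChain.mu_mul_invm_ne_top x),
      ← ENNReal.tsum_mul_left]
    exact tsum_congr fun n => mul_assoc _ _ _
  · congr 1
    refine tsum_congr fun z => ?_
    by_cases hz : z ∈ (c.branch x)ᶜ
    · simp only [Set.indicator_of_mem hz]
      rw [TreeChain.tsum_survival_eq hx (Or.inl hz), mul_add]
    · simp only [Set.indicator_of_notMem hz, add_zero]
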